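/- Let L > 0 be a real number, and consider the set of 20 rectangular tiles consisting of 4 copies each of the rectangles k × L for k = 1, 2, 3, 4, 5. For every divisor f of 60 with f ≥ 5 (namely f ∈ {5, 6, 10, 12, 15, 20, 30, 60}), this tile set tiles a rectangle of dimensions f × (60L/f). -/

import Mathlib

/-- The axis-aligned `w × h` rectangle `[0,w] × [0,h]` in the plane. -/
def rectWH (w h : ℝ) : Set (ℝ × ℝ) := Set.Icc 0 w ×ˢ Set.Icc 0 h

/-- `S` is a placement of a `w × h` rectangle: a translate of `[0,w] × [0,h]`, optionally
preceded by a 90° rotation (which interchanges the roles of `w` and `h`). -/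
def IsPlacement (w h : ℝ) (S : Set (ℝ × ℝ)) : Prop :=
  ∃ v : ℝ × ℝ, S = (fun p => p + v) '' rectWH w h ∨ S = (fun p => p + v) '' rectWH h w

/-- The tile set `dims` (of `n` rectangles) tiles a `W × H` rectangle: there exist placements
of the tiles with pairwise disjoint interiors whose union is `[0,W] × [0,H]`. -/
def TilesRect {n : ℕ} (dims : Fin n → ℝ × ℝ) (W H : ℝ) : Prop :=
  ∃ P : Fin n → Set (ℝ × ℝ),
    (∀ i, IsPlacement (dims i).1 (dims i).2 (P i)) ∧
    (∀ i j, i ≠ j → interior (P i) ∩ interior (P j) = ∅) ∧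
    (⋃ i, P i) = rectWH W H

/-- The 20 tiles: 4 copies each of the rectangles `k × L` for `k = 1, 2, 3, 4, 5`. -/
noncomputable def dims10 (L : ℝ) : Fin 20 → ℝ × ℝ :=
  fun i => ((((i : ℕ) / 4 + 1 : ℕ) : ℝ), L)

/-- The translate of `[0,w] × [0,h]` by `v` as a product of intervals. -/
lemma image_add_rectWH (w h : ℝ) (v : ℝ × ℝ) :
    (fun p => p + v) '' rectWH w h =
      Set.Icc v.1 (v.1 + w) ×ˢ Set.Icc v.2 (v.2 + h) := by
  ext ⟨a, b⟩
  simp only [rectWH, Set.mem_image, Set.mem_prod, Set.mem_Icc, Prod.exists, Prod.ext_iff,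
    Prod.fst_add, Prod.snd_add]
  constructor
  · rintro ⟨c, d, ⟨⟨_, _⟩, _, _⟩, rfl, rfl⟩
    refine ⟨⟨?_, ?_⟩, ?_, ?_⟩ <;> linarith
  · rintro ⟨⟨_, _⟩, _, _⟩
    exact ⟨a - v.1, b - v.2, ⟨⟨by linarith, by linarith⟩, by linarith, by linarith⟩,
      by ring, by ring⟩

lemma exists_nat_unit_interval {n : ℕ} (hn : 0 < n) {t : ℝ} (h0 : 0 ≤ t) (h1 : t ≤ n) :
    ∃ c < n, (c : ℝ) ≤ t ∧ t ≤ c + 1 := by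
  rcases h1.eq_or_lt with rfl | h1
  · refine ⟨n - 1, by omega, ?_, ?_⟩ <;> rw [Nat.cast_pred hn] <;> linarith
  · exact ⟨⌊t⌋₊, (Nat.floor_lt h0).2 h1, Nat.floor_le h0, (Nat.lt_floor_add_one t).le⟩

/-- Tiles of integer widths `w i` and common height `L` tile an `f × RL` rectangle if they can be
put, tile `i` at integer offset `x i` in row `r i`, so that they cover every cell of an `f × R`
grid, stay inside it and do not overlap. -/
lemma tilesRect_of_rows {n : ℕ} {L : ℝ} (hL : 0 < L) {w r x : Fin n → ℕ} {f R : ℕ}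
    (hf : 0 < f) (hR : 0 < R)
    (inside : ∀ i, r i < R ∧ x i + w i ≤ f)
    (disj : ∀ i j, i ≠ j → r i = r j → x i + w i ≤ x j ∨ x j + w j ≤ x i)
    (cover : ∀ s < R, ∀ c < f, ∃ i, r i = s ∧ x i ≤ c ∧ c < x i + w i) :
    TilesRect (fun i => ((w i : ℝ), L)) f (R * L) := by
  refine ⟨fun i => Set.Icc (x i : ℝ) (x i + w i) ×ˢ Set.Icc (r i * L) (r i * L + L),
    fun i => ⟨(x i, r i * L), Or.inl (image_add_rectWH (w i) L (x i, r i * L)).symm⟩,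
    fun i j hij => ?_, ?_⟩
  · ext ⟨a, b⟩
    simp only [interior_prod_eq, interior_Icc, Set.mem_inter_iff, Set.mem_prod, Set.mem_Ioo,
      Set.mem_empty_iff_false, iff_false]
    rintro ⟨⟨⟨_, _⟩, _, _⟩, ⟨_, _⟩, _, _⟩
    rcases lt_trichotomy (r i) (r j) with h | h | h
    · have : (r i : ℝ) + 1 ≤ r j := by exact_mod_cast h
      nlinarith
    · rcases disj i j hij h with h | h
      · have : (x i : ℝ) + w i ≤ x j := by exact_mod_cast h
        linarith
      · have : (x j : ℝ) + w j ≤ x i := by exact_mod_cast h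
        linarith
    · have : (r j : ℝ) + 1 ≤ r i := by exact_mod_cast h
      nlinarith
  · ext ⟨a, b⟩
    simp only [rectWH, Set.mem_iUnion, Set.mem_prod, Set.mem_Icc]
    constructor
    · rintro ⟨i, ⟨h1, h2⟩, h3, h4⟩
      obtain ⟨hr, hx⟩ := inside i
      have hr : (r i : ℝ) + 1 ≤ R := by exact_mod_cast hr
      have hx : (x i : ℝ) + w i ≤ f := by exact_mod_cast hx
      exact ⟨⟨(Nat.cast_nonneg _).trans h1, h2.trans hx⟩,
        (by positivity : 0 ≤ (r i : ℝ) * L).trans h3, by nlinarith⟩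
    · rintro ⟨⟨h1, h2⟩, h3, h4⟩
      obtain ⟨c, hc, hca, hac⟩ := exists_nat_unit_interval hf h1 h2
      obtain ⟨s, hs, hsb, hbs⟩ := exists_nat_unit_interval hR (div_nonneg h3 hL.le)
        ((div_le_iff₀ hL).2 h4)
      rw [le_div_iff₀ hL] at hsb
      rw [div_le_iff₀ hL] at hbs
      obtain ⟨i, rfl, hxc, hcx⟩ := cover s hs c hc
      have hxc : (x i : ℝ) ≤ c := by exact_mod_cast hxc
      have hcx : (c : ℝ) + 1 ≤ x i + w i := by exact_mod_cast hcx
      exact ⟨i, ⟨by linarith, by linarith⟩, hsb, by linarith⟩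

/-- Row of tile `i` when the tiles are arranged in twelve rows `5`, `4 + 1`, `3 + 2`. -/
def rowFive (i : Fin 20) : ℕ := ![0, 4, 4, 0, 8] (Fin.ofNat 5 (i / 4)) + i % 4

/-- Offset of tile `i` when the tiles are arranged in twelve rows `5`, `4 + 1`, `3 + 2`. -/
def offsetFive (i : Fin 20) : ℕ := ![4, 3, 0, 0, 0] (Fin.ofNat 5 (i / 4))

/-- Row of tile `i` when the tiles are arranged in ten rows `5 + 1`, `4 + 2`, `3 + 3`. -/
def rowSix (i : Fin 20) : ℕ :=
  ![i % 4, 4 + i % 4, 8 + i % 4 / 2, 4 + i % 4, i % 4] (Fin.ofNat 5 (i / 4))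

/-- Offset of tile `i` when the tiles are arranged in ten rows `5 + 1`, `4 + 2`, `3 + 3`. -/
def offsetSix (i : Fin 20) : ℕ := ![5, 4, 3 * (i % 2), 0, 0] (Fin.ofNat 5 (i / 4))

/-- Concatenating every `m` consecutive rows of length `g` of an arrangement of the twenty tiles
in `m * R` rows gives a tiling with `R` rows. -/
lemma tilesRect_dims10_of_rows {L : ℝ} (hL : 0 < L) {r x : Fin 20 → ℕ} {g m R : ℕ}
    (hg : 0 < g) (hm : 0 < m) (hR : 0 < R)
    (inside : ∀ i, r i < m * R ∧ x i + (i / 4 + 1) ≤ g)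
    (disj : ∀ i j, i ≠ j → r i = r j → x i + (i / 4 + 1) ≤ x j ∨ x j + (j / 4 + 1) ≤ x i)
    (cover : ∀ s < m * R, ∀ c < g, ∃ i, r i = s ∧ x i ≤ c ∧ c < x i + (i / 4 + 1)) :
    TilesRect (dims10 L) (g * m : ℕ) (R * L) := by
  refine tilesRect_of_rows hL (w := fun i => i / 4 + 1) (r := fun i => r i / m)
    (x := fun i => g * (r i % m) + x i) (by positivity) hR (fun i => ?_) (fun i j hij h => ?_)
    fun s hs c hc => ?_
  · obtain ⟨h1, h2⟩ := inside i
    refine ⟨Nat.div_lt_of_lt_mul h1, ?_⟩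
    have := Nat.mul_le_mul_left g (Nat.mod_lt (r i) hm)
    rw [Nat.mul_succ] at this
    omega
  · rcases lt_trichotomy (r i % m) (r j % m) with hlt | heq | hlt
    · have := Nat.mul_le_mul_left g hlt
      have := (inside i).2
      rw [Nat.mul_succ] at *
      omega
    · have hr : r i = r j := by rw [← Nat.div_add_mod (r i) m, ← Nat.div_add_mod (r j) m, h, heq]
      have := disj i j hij hr
      rw [hr]
      omega
    · have := Nat.mul_le_mul_left g hlt
      have := (inside j).2
      rw [Nat.mul_succ] at *
      omega
  · have hcm : c / g < m := Nat.div_lt_of_lt_mul hc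
    have hlt : m * s + c / g < m * R := by
      have := Nat.mul_le_mul_left m hs
      rw [Nat.mul_succ] at this
      omega
    obtain ⟨i, hi, h1, h2⟩ := cover _ hlt (c % g) (Nat.mod_lt _ hg)
    have hdm := Nat.div_add_mod c g
    refine ⟨i, ?_, ?_⟩
    · rw [hi, Nat.mul_add_div hm, Nat.div_eq_of_lt hcm, add_zero]
    · rw [hi, Nat.mul_add_mod, Nat.mod_eq_of_lt hcm]
      omega

lemma tilesRect_dims10_five {L : ℝ} (hL : 0 < L) {m R : ℕ} (h : m * R = 12) :
    TilesRect (dims10 L) (5 * m : ℕ) (R * L) := by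
  refine tilesRect_dims10_of_rows hL (r := rowFive) (x := offsetFive) (by norm_num)
    (Nat.pos_of_ne_zero (by rintro rfl; omega)) (Nat.pos_of_ne_zero (by rintro rfl; omega))
    ?_ ?_ ?_ <;> (try rw [h]) <;> decide

lemma tilesRect_dims10_six {L : ℝ} (hL : 0 < L) {m R : ℕ} (h : m * R = 10) :
    TilesRect (dims10 L) (6 * m : ℕ) (R * L) := by
  refine tilesRect_dims10_of_rows hL (r := rowSix) (x := offsetSix) (by norm_num)
    (Nat.pos_of_ne_zero (by rintro rfl; omega)) (Nat.pos_of_ne_zero (by rintro rfl; omega))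
    ?_ ?_ ?_ <;> (try rw [h]) <;> decide

/-- For every `L > 0` and every divisor `f` of `60` with `f ≥ 5`, the set of 20 tiles
consisting of 4 copies each of `k × L` for `k = 1, …, 5` tiles an `f × (60L/f)` rectangle. -/
theorem twenty_tiles_layouts (L : ℝ) (hL : 0 < L) (f : ℕ) (hf : f ∣ 60) (hf5 : 5 ≤ f) :
    TilesRect (dims10 L) (f : ℝ) (60 * L / (f : ℝ)) := by
  obtain ⟨R, hR⟩ := hf
  have hH : 60 * L / (f : ℝ) = R * L := by
    have h : (60 : ℝ) = f * R := by exact_mod_cast hR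
    rw [h]
    field_simp
  rw [hH]
  have hmod : f % 5 = 0 ∨ f % 6 = 0 := by
    have : R ≤ 12 := by nlinarith
    interval_cases R <;> omega
  rcases hmod with h | h
  · obtain ⟨m, rfl⟩ := Nat.dvd_of_mod_eq_zero h
    exact tilesRect_dims10_five hL (by linarith)
  · obtain ⟨m, rfl⟩ := Nat.dvd_of_mod_eq_zero h
    exact tilesRect_dims10_six hL (by linarith)
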